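/- arXiv:1603.03475 — 5 statements merged into one kernel-verified Lean document; each statement's English description precedes it below -/
import Mathlib

section
/- Let (g, h) be an infomorphism from the classification A = (X₁, Y, ⊨₁) to the classification B = (X₂, Z, ⊨₂), and let T be a Y-theory such that A satisfies T (the logic (A, T) is sound). Then B satisfies the direct image theory g[T] = { (g[Γ], g[Δ]) : (Γ, Δ) ∈ T }; that is, the direct image logic (B, g[T]) is sound. (Direct image along a structure morphism preserves soundness.) -/
universe u

/-- A classification with type set `Y`: an instance set together with a
binary (classification) relation between instances and types. -/
structure Classification (Y : Type u) : Type (u + 1) where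
  Inst : Type u
  rel : Inst → Y → Prop

/-- A `Y`-sequent: a pair of subsets of `Y`. -/
abbrev Sequent (Y : Type u) := Set Y × Set Y

/-- A classification satisfies a sequent `(Γ, Δ)` when every instance
classified by all types in `Γ` is classified by some type in `Δ`. -/
def Classification.Satisfies {Y : Type u} (A : Classification Y) (s : Sequent Y) : Prop :=
  ∀ x : A.Inst, (∀ y ∈ s.1, A.rel x y) → ∃ y ∈ s.2, A.rel x y

/-- Translation of a sequent along a function on types, by direct images. -/
def Sequent.translate {Y Z : Type u} (g : Y → Z) (s : Sequent Y) : Sequent Z :=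
  (g '' s.1, g '' s.2)

/-- The `g`-reduct of a classification: same instances, with `x ⊨_g y` iff `x ⊨ g y`. -/
def Classification.reduct {Y Z : Type u} (C : Classification Z) (g : Y → Z) :
    Classification Y :=
  ⟨C.Inst, fun x y => C.rel x (g y)⟩

/-- A `Y`-theory: a set of `Y`-sequents. -/
abbrev SequentTheory (Y : Type u) := Set (Sequent Y)

/-- A classification satisfies a theory when it satisfies each of its members. -/
def Classification.SatisfiesTheory {Y : Type u} (A : Classification Y)
    (T : SequentTheory Y) : Prop :=
  ∀ s ∈ T, A.Satisfies s

/-- A theory entails a sequent when every classification (with the same type set)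
satisfying the theory satisfies the sequent. -/
def Entails {Y : Type u} (T : SequentTheory Y) (s : Sequent Y) : Prop :=
  ∀ A : Classification Y, A.SatisfiesTheory T → A.Satisfies s

/-- Direct image along a structure morphism preserves soundness: if `(g, h)` is an
infomorphism from `A` to `B` and `A` satisfies the theory `T`, then `B` satisfies
the direct image theory `g[T]`. -/
theorem dir_preserves_soundness {Y Z : Type u} (A : Classification Y)
    (B : Classification Z) (g : Y → Z) (h : B.Inst → A.Inst)
    (info : ∀ (x : B.Inst) (y : Y), B.rel x (g y) ↔ A.rel (h x) y)
    (T : SequentTheory Y) (hA : A.SatisfiesTheory T) :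
    B.SatisfiesTheory (Sequent.translate g '' T) := by
  rintro _ ⟨s, hs, rfl⟩ x hx
  obtain ⟨y, hy, hr⟩ := hA s hs (h x)
    (fun y hy => (info x y).1 (hx (g y) (Set.mem_image_of_mem g hy)))
  exact ⟨g y, Set.mem_image_of_mem g hy, (info x y).2 hr⟩
end

section
/- Let (g, h) be an infomorphism from the classification A = (X₁, Y, ⊨₁) to the classification B = (X₂, Z, ⊨₂), and let T₂ be a Z-theory such that every Z-sequent satisfied by B is entailed by T₂ (the logic (B, T₂) is complete). Then every Y-sequent (Γ, Δ) satisfied by A satisfies T₂ ⊢_Z (g[Γ], g[Δ]); hence every Y-sequent satisfied by A belongs to (and in particular is entailed by) the inverse image theory { t : T₂ ⊢_Z (translation of t along g) }, so the inverse image logic is complete. (Inverse image along a structure morphism preserves completeness.) -/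
universe u

/-- Inverse image along a structure morphism preserves completeness: if `(g, h)` is an
infomorphism from `A` to `B` and the logic `(B, T₂)` is complete, then every sequent
satisfied by `A` has its translation entailed by `T₂` (so it belongs to the inverse
image theory and the inverse image logic is complete). -/
theorem inv_preserves_completeness {Y Z : Type u} (A : Classification Y)
    (B : Classification Z) (g : Y → Z) (h : B.Inst → A.Inst)
    (info : ∀ (x : B.Inst) (y : Y), B.rel x (g y) ↔ A.rel (h x) y)
    (T₂ : SequentTheory Z)
    (hcomp : ∀ s : Sequent Z, B.Satisfies s → Entails T₂ s)
    (t : Sequent Y) (hA : A.Satisfies t) :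
    Entails T₂ (t.translate g) := by
  refine hcomp _ fun x hx => ?_
  obtain ⟨y, hy, hr⟩ := hA (h x) fun y hy =>
    (info x y).1 (hx (g y) (Set.mem_image_of_mem g hy))
  exact ⟨g y, Set.mem_image_of_mem g hy, (info x y).2 hr⟩
end

section
/- Let g : Y → Z be a function and T₁ a Y-theory. For every Y-sequent (Γ, Δ): if T₁ ⊢_Y (Γ, Δ), then the direct image theory g[T₁] = { (g[Γ′], g[Δ′]) : (Γ′, Δ′) ∈ T₁ } entails the translated sequent, g[T₁] ⊢_Z (g[Γ], g[Δ]). (g is a theory morphism from (Y, T₁) to (Z, g[T₁]): entailment is preserved along the direct image.) -/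
universe u

/-- A classification satisfies a translated sequent iff its reduct satisfies the sequent. -/
theorem satisfies_translate_iff {Y Z : Type u} (g : Y → Z) (C : Classification Z)
    (s : Sequent Y) : C.Satisfies (s.translate g) ↔ (C.reduct g).Satisfies s := by
  constructor
  · intro h x hx
    obtain ⟨_, ⟨y, hy, rfl⟩, hr⟩ := h x (by rintro _ ⟨y, hy, rfl⟩; exact hx y hy)
    exact ⟨y, hy, hr⟩
  · intro h x hx
    obtain ⟨y, hy, hr⟩ := h x (fun y hy => hx (g y) ⟨y, hy, rfl⟩)
    exact ⟨g y, ⟨y, hy, rfl⟩, hr⟩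

/-- Entailment is preserved along the direct image: `g` is a theory morphism from
`(Y, T₁)` to `(Z, g[T₁])`. -/
theorem entails_translate_of_entails {Y Z : Type u} (g : Y → Z)
    (T₁ : SequentTheory Y) (t : Sequent Y) (h : Entails T₁ t) :
    Entails (Sequent.translate g '' T₁) (t.translate g) := by
  intro C hC
  refine (satisfies_translate_iff g C t).2 (h _ fun s hs => ?_)
  exact (satisfies_translate_iff g C s).1 (hC _ ⟨s, hs, rfl⟩)
end

section
/- Let g : Y → Z be a function and T₂ a Z-theory, and let inv(g)(T₂) = { t a Y-sequent : T₂ ⊢_Z (translation of t along g) } be the inverse image theory. Then for every Y-sequent t: if inv(g)(T₂) ⊢_Y t, then T₂ ⊢_Z (translation of t along g). (g is a theory morphism from (Y, inv(g)(T₂)) to (Z, T₂).) -/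
universe u

/-- `g` is a theory morphism from `(Y, inv(g)(T₂))` to `(Z, T₂)`: whatever the inverse
image theory entails has its translation entailed by `T₂`. -/
theorem inv_image_theory_morphism {Y Z : Type u} (g : Y → Z)
    (T₂ : SequentTheory Z) (t : Sequent Y)
    (h : Entails {t : Sequent Y | Entails T₂ (t.translate g)} t) :
    Entails T₂ (t.translate g) := by
  have key : ∀ (C : Classification Z) (s : Sequent Y),
      (C.reduct g).Satisfies s ↔ C.Satisfies (Sequent.translate g s) := by
    intro C s
    simp only [Classification.Satisfies, Classification.reduct, Sequent.translate,
      Set.forall_mem_image, Set.exists_mem_image]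
  intro C hC
  exact (key C t).1 (h (C.reduct g) fun s hs => (key C s).2 (hs C hC))
end

section
/- The category Cls of classifications and infomorphisms — whose objects are triples (X, Y, ⊨) of an instance type X, a type type Y, and a relation ⊨ between X and Y, and whose morphisms from (X₁, Y, ⊨₁) to (X₂, Z, ⊨₂) are pairs (g : Y → Z, h : X₂ → X₁) with x ⊨₂ g(y) iff h(x) ⊨₁ y, composed componentwise — has all small colimits (is cocomplete). -/
open CategoryTheory

universe u

/-- A classification: an instance type, a type type, and a classification relation. -/
structure Cls : Type (u + 1) where
  Inst : Type u
  Typ : Type u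
  rel : Inst → Typ → Prop

/-- An infomorphism between classifications: a covariant type function and a
contravariant instance function satisfying the fundamental condition. -/
@[ext]
structure Infomorphism (A B : Cls.{u}) : Type u where
  typMap : A.Typ → B.Typ
  instMap : B.Inst → A.Inst
  cond : ∀ (x : B.Inst) (y : A.Typ), B.rel x (typMap y) ↔ A.rel (instMap x) y

/-- The category of classifications and infomorphisms, composed componentwise. -/
instance : Category Cls.{u} where
  Hom := Infomorphism
  id A := ⟨id, id, fun _ _ => Iff.rfl⟩
  comp f g := ⟨g.typMap ∘ f.typMap, f.instMap ∘ g.instMap,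
    fun x y => (g.cond x (f.typMap y)).trans (f.cond (g.instMap x) y)⟩

namespace ClsColim

variable {J : Type u} [Category.{u} J] (F : J ⥤ Cls.{u})

/-- Compatible families of instances. -/
abbrev CInst : Type u :=
  {s : (j : J) → (F.obj j).Inst // ∀ (i j : J) (f : i ⟶ j),
    Infomorphism.instMap (F.map f) (s j) = s i}

/-- Generating relation on the disjoint union of types. -/
def step (a b : Σ j : J, (F.obj j).Typ) : Prop :=
  ∃ f : a.1 ⟶ b.1, b.2 = Infomorphism.typMap (F.map f) a.2

/-- The colimit classification. -/
def pt : Cls.{u} where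
  Inst := CInst F
  Typ := Quot (step F)
  rel s := Quot.lift (fun a => (F.obj a.1).rel (s.1 a.1) a.2) (by
    rintro ⟨i, y⟩ ⟨j, z⟩ ⟨f, h⟩
    dsimp only at f h ⊢
    subst h
    have h1 := Infomorphism.cond (F.map f) (s.1 j) y
    rw [s.2 i j f] at h1
    exact propext h1.symm)

/-- The colimit cocone. -/
def cocone : Limits.Cocone F where
  pt := pt F
  ι :=
    { app := fun j =>
        (⟨fun y => Quot.mk _ ⟨j, y⟩, fun s => s.1 j, fun _ _ => Iff.rfl⟩ :
          Infomorphism (F.obj j) (pt F))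
      naturality := by
        intro i j f
        apply Infomorphism.ext
        · funext y
          exact (Quot.sound ⟨f, rfl⟩).symm
        · funext s
          exact s.2 i j f }

theorem w_typ (c : Limits.Cocone F) {i j : J} (f : i ⟶ j) (y : (F.obj i).Typ) :
    Infomorphism.typMap (c.ι.app j) (Infomorphism.typMap (F.map f) y) =
      Infomorphism.typMap (c.ι.app i) y :=
  congrFun (congrArg Infomorphism.typMap (c.w f)) y

theorem w_inst (c : Limits.Cocone F) {i j : J} (f : i ⟶ j) (x : c.pt.Inst) :
    Infomorphism.instMap (F.map f) (Infomorphism.instMap (c.ι.app j) x) =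
      Infomorphism.instMap (c.ι.app i) x :=
  congrFun (congrArg Infomorphism.instMap (c.w f)) x

/-- The mediating infomorphism. -/
def desc (c : Limits.Cocone F) : Infomorphism (pt F) c.pt where
  typMap := Quot.lift (fun a => Infomorphism.typMap (c.ι.app a.1) a.2) (by
    rintro ⟨i, y⟩ ⟨j, z⟩ ⟨f, h⟩
    dsimp only at f h ⊢
    subst h
    exact (w_typ F c f y).symm)
  instMap x := ⟨fun j => Infomorphism.instMap (c.ι.app j) x, fun _ _ f => w_inst F c f x⟩
  cond := by
    rintro x ⟨⟨j, y⟩⟩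
    exact Infomorphism.cond (c.ι.app j) x y

/-- The cocone is a colimit. -/
def isColimit : Limits.IsColimit (cocone F) where
  desc c := desc F c
  fac c j := Infomorphism.ext rfl rfl
  uniq c m hm := by
    apply Infomorphism.ext
    · funext q
      obtain ⟨⟨j, y⟩⟩ := q
      exact congrFun (congrArg Infomorphism.typMap (hm j)) y
    · funext x
      apply Subtype.ext
      funext j
      exact congrFun (congrArg Infomorphism.instMap (hm j)) x

end ClsColim

/-- The category of classifications and infomorphisms is cocomplete. -/
theorem Cls.hasColimits : Limits.HasColimits Cls.{u} := by
  exact { has_colimits_of_shape := fun J _ =>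
    { has_colimit := fun F => ⟨⟨⟨ClsColim.cocone F, ClsColim.isColimit F⟩⟩⟩ } }
end
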